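/- Let α > 0, a > 0 and z₀ ∈ (0,1). Set τ = α/(a z₀^{1/α}) and ẑ(t) = z₀ (1 - t/τ)^{-α} for t ∈ [0, τ). Define the discrete orbit by z_{t+1} = z_t + a z_t^{1 + 1/α} starting from z₀. Then for every integer t with 0 ≤ t < τ, one has z_t ≤ ẑ(t). -/

import Mathlib

/-- Bernoulli's inequality for a negative exponent. -/
theorem one_add_mul_le_one_sub_rpow_neg {α s : ℝ} (hα : 0 ≤ α) (hs : s < 1) :
    1 + α * s ≤ (1 - s) ^ (-α) := by
  have hpos : 0 < 1 - s := by linarith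
  rw [Real.rpow_def_of_pos hpos]
  have hlog := mul_le_mul_of_nonneg_left (Real.log_le_sub_one_of_pos hpos) hα
  have hexp := Real.add_one_le_exp (Real.log (1 - s) * -α)
  linarith

/-- The curve `c * u ^ (-α)` with `a * c ^ (1/α) = α * δ` dominates its own Euler step when `u`
decreases by `δ`. -/
theorem euler_step_le_rpow_neg {α a c u δ : ℝ} (hα : 0 < α) (hc : 0 < c) (hu : 0 < u)
    (hδ : δ < u) (hac : a * c ^ (1 / α) = α * δ) :
    c * u ^ (-α) + a * (c * u ^ (-α)) ^ (1 + 1 / α) ≤ c * (u - δ) ^ (-α) := by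
  have hup : 0 < u ^ (-α) := Real.rpow_pos_of_pos hu _
  have hs : δ / u < 1 := (div_lt_one hu).2 hδ
  have hroot : (c * u ^ (-α)) ^ (1 / α) = c ^ (1 / α) * u⁻¹ := by
    rw [Real.mul_rpow hc.le hup.le, ← Real.rpow_mul hu.le,
      show -α * (1 / α) = -1 by field_simp, Real.rpow_neg_one]
  have hfactor : (u - δ) ^ (-α) = u ^ (-α) * (1 - δ / u) ^ (-α) := by
    rw [← Real.mul_rpow hu.le (by linarith), mul_sub, mul_one, mul_div_cancel₀ _ hu.ne']
  calc c * u ^ (-α) + a * (c * u ^ (-α)) ^ (1 + 1 / α)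
      = c * u ^ (-α) * (1 + a * c ^ (1 / α) * u⁻¹) := by
        rw [Real.rpow_add (mul_pos hc hup), Real.rpow_one, hroot]; ring
    _ = c * u ^ (-α) * (1 + α * (δ / u)) := by rw [hac]; ring
    _ ≤ c * u ^ (-α) * (1 - δ / u) ^ (-α) := by
        gcongr
        exact one_add_mul_le_one_sub_rpow_neg hα.le hs
    _ = c * (u - δ) ^ (-α) := by rw [hfactor]; ring

/-- The discrete orbit `z_{t+1} = z_t + a z_t^{1+1/α}` starting from `z₀` is dominated by the
ODE solution `z̃(t) = z₀ (1 - t/τ)^{-α}`, `τ = α/(a z₀^{1/α})`, for integer times `t < τ`. -/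
theorem stmt6 (α a z₀ τ : ℝ) (hα : 0 < α) (ha : 0 < a) (hz₀ : z₀ ∈ Set.Ioo (0:ℝ) 1)
    (hτ : τ = α / (a * z₀ ^ (1/α)))
    (zt : ℝ → ℝ) (hzt : ∀ t : ℝ, zt t = z₀ * (1 - t/τ) ^ (-α))
    (z : ℕ → ℝ) (hz0 : z 0 = z₀)
    (hrec : ∀ t : ℕ, z (t+1) = z t + a * z t ^ (1 + 1/α)) :
    ∀ t : ℕ, (t : ℝ) < τ → z t ≤ zt t := by
  obtain ⟨hz₀, -⟩ := hz₀
  have hroot : 0 < z₀ ^ (1 / α) := Real.rpow_pos_of_pos hz₀ _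
  have hτ_pos : 0 < τ := by rw [hτ]; positivity
  have hac : a * z₀ ^ (1 / α) = α * (1 / τ) := by
    rw [hτ]; field_simp
  have hz_pos : ∀ t, 0 < z t := by
    intro t
    induction t with
    | zero => rwa [hz0]
    | succ t ih =>
      rw [hrec]
      positivity
  intro t
  induction t with
  | zero => simp [hz0, hzt]
  | succ t ih =>
    intro ht
    push_cast at ht
    have hle := ih (by linarith)
    have hu : 1 / τ < 1 - t / τ := by
      rw [lt_sub_iff_add_lt, ← add_div, div_lt_one hτ_pos]
      linarith
    have hu_pos : 0 < 1 - t / τ := (one_div_pos.2 hτ_pos).trans hu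
    calc z (t + 1) = z t + a * z t ^ (1 + 1 / α) := hrec t
      _ ≤ zt t + a * zt t ^ (1 + 1 / α) := by
        have := (hz_pos t).le
        gcongr
      _ ≤ z₀ * (1 - t / τ - 1 / τ) ^ (-α) := by
        rw [hzt]
        exact euler_step_le_rpow_neg hα hz₀ hu_pos hu hac
      _ = zt (t + 1 : ℕ) := by
        rw [hzt, sub_sub, ← add_div]
        push_cast
        rfl
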